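/- Let D be a finite abelian group with a non-degenerate quadratic form q into ℚ/ℤ, of exponent a power of a prime p, and γ ∈ D. If γ^⊥ contains an isotropic subgroup H isomorphic to (ℤ/pℤ)^2, then e^γ lies in the span of the images of the isotropic lifts ↑_K over nontrivial isotropic subgroups K of D. -/

import Mathlib

open scoped Classical BigOperators

noncomputable section

/-- The bilinear form associated to a quadratic form `q : D → ℚ/ℤ`. -/
def bil {D : Type*} [AddCommGroup D] (q : D → AddCircle (1 : ℚ)) (x y : D) :
    AddCircle (1 : ℚ) :=
  q (x + y) - q x - q y

/-- The standard basis vector `e^γ` of `ℂ[D]`. -/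
def eV {D : Type*} (γ : D) : D → ℂ := fun β => if β = γ then 1 else 0

/-- `↑_K(e^{γ+K}) = ∑_{μ ∈ K} e^{γ+μ}`, as an element of `ℂ[D]`. -/
def liftVec {D : Type*} [AddCommGroup D] (K : AddSubgroup D) (γ : D) : D → ℂ :=
  fun β => if β - γ ∈ K then 1 else 0

/-- `im(↑) = ∑_K im(↑_K)`, the span of all isotropic lifts over nontrivial
isotropic subgroups `K` of `D`. -/
def imUp {D : Type*} [AddCommGroup D] (q : D → AddCircle (1 : ℚ)) :
    Submodule ℂ (D → ℂ) :=
  Submodule.span ℂ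
    {v | ∃ K : AddSubgroup D, K ≠ ⊥ ∧ (∀ x ∈ K, q x = 0) ∧
      ∃ γ : D, (∀ μ ∈ K, bil q γ μ = 0) ∧ v = liftVec K γ}

/-- The line of slope `a` through the origin in the plane over `ZMod p`. -/
def lineOfSlope (p : ℕ) (a : ZMod p) : AddSubgroup (ZMod p × ZMod p) :=
  (AddMonoidHom.snd _ _ - (AddMonoidHom.mulLeft a).comp (AddMonoidHom.fst _ _)).ker

lemma mem_lineOfSlope {p : ℕ} {a : ZMod p} {w : ZMod p × ZMod p} :
    w ∈ lineOfSlope p a ↔ w.2 = a * w.1 := by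
  simp [lineOfSlope, AddMonoidHom.mem_ker, sub_eq_zero]

lemma mem_ker_fst {p : ℕ} {w : ZMod p × ZMod p} :
    w ∈ (AddMonoidHom.fst (ZMod p) (ZMod p)).ker ↔ w.1 = 0 := Iff.rfl

/-- The `p + 1` lines through the origin cover each nonzero vector of the plane once and the
origin `p + 1` times. -/
lemma sum_indicator_lines {p : ℕ} [Fact p.Prime] (w : ZMod p × ZMod p) :
    (∑ a : ZMod p, if w ∈ lineOfSlope p a then (1 : ℂ) else 0)
      + (if w ∈ (AddMonoidHom.fst (ZMod p) (ZMod p)).ker then 1 else 0)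
      = 1 + p * if w = 0 then 1 else 0 := by
  obtain ⟨u, v⟩ := w
  simp only [mem_lineOfSlope, mem_ker_fst, Prod.mk_eq_zero]
  by_cases hu : u = 0
  · by_cases hv : v = 0 <;> simp [hu, hv, ZMod.card, add_comm]
  · have h (a : ZMod p) : v = a * u ↔ a = v / u := by
      rw [eq_div_iff hu, eq_comm]
    simp [h, hu]

section Lift

variable {D : Type*} [AddCommGroup D]

lemma liftVec_mem_imUp {q : D → AddCircle (1 : ℚ)} {K : AddSubgroup D} {γ : D} (hK : K ≠ ⊥)
    (hiso : ∀ x ∈ K, q x = 0) (hperp : ∀ x ∈ K, bil q γ x = 0) : liftVec K γ ∈ imUp q :=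
  Submodule.subset_span ⟨K, hK, hiso, γ, hperp, rfl⟩

lemma liftVec_map_apply {A : Type*} [AddCommGroup A] {f : A →+ D} (hf : Function.Injective f)
    (S : AddSubgroup A) (γ : D) (w : A) :
    liftVec (S.map f) γ (γ + f w) = if w ∈ S then 1 else 0 := by
  simp only [liftVec, add_sub_cancel_left, AddSubgroup.mem_map_iff_mem hf]

lemma liftVec_map_apply_of_notMem {A : Type*} [AddCommGroup A] {f : A →+ D}
    (S : AddSubgroup A) {γ β : D} (h : β - γ ∉ f.range) : liftVec (S.map f) γ β = 0 :=
  if_neg fun ⟨w, _, hw⟩ => h ⟨w, hw⟩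

/-- Summing the lifts over all lines of a plane counts the plane once and the base point
`p` additional times. -/
lemma sum_liftVec_lines {p : ℕ} [Fact p.Prime] {f : ZMod p × ZMod p →+ D}
    (hf : Function.Injective f) (γ : D) :
    (∑ a : ZMod p, liftVec ((lineOfSlope p a).map f) γ)
      + liftVec ((AddMonoidHom.fst (ZMod p) (ZMod p)).ker.map f) γ
      = liftVec ((⊤ : AddSubgroup (ZMod p × ZMod p)).map f) γ + (p : ℂ) • eV γ := by
  ext β
  simp only [Pi.add_apply, Finset.sum_apply, Pi.smul_apply, smul_eq_mul]
  by_cases hβ : β - γ ∈ f.range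
  · obtain ⟨w, hw⟩ := hβ
    obtain rfl : β = γ + f w := by rw [hw]; abel
    simp only [liftVec_map_apply hf, AddSubgroup.mem_top, if_true, eV, add_eq_left,
      map_eq_zero_iff f hf]
    convert sum_indicator_lines w
  · have hne : β ≠ γ := by
      rintro rfl
      exact hβ (by simp)
    simp [liftVec_map_apply_of_notMem _ hβ, eV, hne]

end Lift

/-- Let `D` be a finite abelian group with a non-degenerate quadratic form into
`ℚ/ℤ`, of exponent a power of a prime `p`, and `γ ∈ D`.  If `γ^⊥` contains an
isotropic subgroup `H` isomorphic to `(ℤ/pℤ)²`, then `e^γ ∈ im(↑)`. -/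
theorem basisVec_mem_imUp_of_isotropic_rank_two
    {D : Type*} [AddCommGroup D] [Fintype D] (p : ℕ) (hp : p.Prime)
    (q : D → AddCircle (1 : ℚ))
    (hquad : ∀ (n : ℤ) (x : D), q (n • x) = (n ^ 2 : ℤ) • q x)
    (hbil : ∀ x y z : D, bil q (x + y) z = bil q x z + bil q y z)
    (hnd : ∀ x : D, (∀ y : D, bil q x y = 0) → x = 0)
    (hexp : ∃ k : ℕ, ∀ x : D, p ^ k • x = 0)
    (γ : D) (H : AddSubgroup D)
    (hiso : ∀ x ∈ H, q x = 0)
    (hperp : ∀ x ∈ H, bil q γ x = 0)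
    (hH2 : Nonempty (H ≃+ (ZMod p × ZMod p))) :
    eV γ ∈ imUp q := by
  have : Fact p.Prime := ⟨hp⟩
  obtain ⟨e⟩ := hH2
  let f : ZMod p × ZMod p →+ D := H.subtype.comp e.symm.toAddMonoidHom
  have hf : Function.Injective f := Subtype.val_injective.comp e.symm.injective
  have hfH (S : AddSubgroup (ZMod p × ZMod p)) : ∀ x ∈ S.map f, x ∈ H := by
    rintro _ ⟨w, -, rfl⟩
    exact (e.symm w).2
  have hmem (S : AddSubgroup (ZMod p × ZMod p)) (w : ZMod p × ZMod p) (hw : w ∈ S)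
      (hw0 : w ≠ 0) : liftVec (S.map f) γ ∈ imUp q := by
    refine liftVec_mem_imUp (fun h => hw0 ?_) (fun x hx => hiso x (hfH S x hx))
      (fun x hx => hperp x (hfH S x hx))
    rw [AddSubgroup.map_eq_bot_iff_of_injective S hf] at h
    simpa [h] using hw
  have hlines := add_mem
    (sum_mem fun a (_ : a ∈ Finset.univ) =>
      hmem (lineOfSlope p a) (1, a) (by simp [mem_lineOfSlope]) (by simp))
    (hmem (AddMonoidHom.fst (ZMod p) (ZMod p)).ker (0, 1) (mem_ker_fst.2 rfl) (by simp))
  rw [sum_liftVec_lines hf, Submodule.add_mem_iff_right _ (hmem ⊤ (1, 0) trivial (by simp)),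
    Submodule.smul_mem_iff _ (Nat.cast_ne_zero.2 hp.ne_zero)] at hlines
  exact hlines
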